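/- Let R be a commutative ring, m ≥ 1, and C an m×m matrix over R. Fix an integer j with 0 ≤ j < m, indices 1 ≤ k₁ < k₂ < … < k_j ≤ m, and an integer s with 1 ≤ s ≤ j+1, and let l₁ < l₂ < … < l_{m−j} enumerate the complement {1,…,m} \ {k₁,…,k_j} in increasing order. Then C(1,…,ŝ,…,j+1 | k₁,…,k_j) · C(1,…,ŝ,…,j+1, s, j+2,…,m | k₁,…,k_j, l₁,…,l_{m−j}) = ∑_{b=1}^{m−j} (−1)^{b+1} · C(1,…,ŝ,…,j+1, s | k₁,…,k_j, l_b) · C(1,…,ŝ,…,j+1, j+2,…,m | k₁,…,k_j, l₁,…,l̂_b,…,l_{m−j}), where ŝ (resp. l̂_b) indicates that the index s (resp. l_b) is omitted from the list. -/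

import Mathlib

namespace Stmt6

/-- Here `m = j + r + 1` (so `0 ≤ j < m` and `m − j = r + 1`).
The row list `(1,…,ŝ,…,j+1)` of length `j`, viewed inside `Fin m`. -/
def rowsOmit (j r : ℕ) (s : Fin (j + 1)) : Fin j → Fin (j + r + 1) :=
  fun u => Fin.castLE (by omega) (s.succAbove u)

/-- The row list `(1,…,ŝ,…,j+1, s, j+2,…,m)` of length `m = j + r + 1`. -/
def rowsBig (j r : ℕ) (s : Fin (j + 1)) : Fin (j + r + 1) → Fin (j + r + 1) :=
  fun u =>
    if h : (u : ℕ) < j + 1 then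
      Fin.castLE (by omega)
        ((Fin.snoc (fun w : Fin j => s.succAbove w) s : Fin (j + 1) → Fin (j + 1)) ⟨u, h⟩)
    else u

/-- The column list `(k₁,…,k_j, l₁,…,l_{m−j})` of length `m = j + r + 1`. -/
def colsBig {j r : ℕ} (k : Fin j → Fin (j + r + 1)) (l : Fin (r + 1) → Fin (j + r + 1)) :
    Fin (j + r + 1) → Fin (j + r + 1) :=
  fun v =>
    if h : (v : ℕ) < j then k ⟨v, h⟩
    else l ⟨(v : ℕ) - j, by have := v.isLt; omega⟩

/-- The column list `(k₁,…,k_j, l₁,…,l̂_b,…,l_{m−j})` of length `m − 1 = j + r`. -/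
def colsOmit {j r : ℕ} (k : Fin j → Fin (j + r + 1)) (l : Fin (r + 1) → Fin (j + r + 1))
    (b : Fin (r + 1)) : Fin (j + r) → Fin (j + r + 1) :=
  fun v =>
    if h : (v : ℕ) < j then k ⟨v, h⟩
    else l (b.succAbove ⟨(v : ℕ) - j, by have := v.isLt; omega⟩)

/-- A minor bordered by the last row of `e`, summed against the cofactors of that row, gives the
minor times the full determinant. -/
theorem det_submatrix_mul_det {R : Type*} [CommRing R] {j n : ℕ}
    (M : Matrix (Fin (n + 1)) (Fin (n + 1)) R) (e : Fin (j + 1) → Fin (n + 1))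
    (he : Function.Injective e) (f : Fin j → Fin (n + 1)) :
    (M.submatrix (e ∘ Fin.castSucc) f).det * M.det
      = ∑ p : Fin (n + 1), (-1 : R) ^ ((e (Fin.last j) : ℕ) + (p : ℕ)) *
          (M.submatrix e (Fin.snoc f p : Fin (j + 1) → Fin (n + 1))).det *
          (M.submatrix (e (Fin.last j)).succAbove p.succAbove).det := by
  have expand (p : Fin (n + 1)) :
      (M.submatrix e (Fin.snoc f p : Fin (j + 1) → Fin (n + 1))).det
        = ∑ u : Fin (j + 1), (-1 : R) ^ ((u : ℕ) + j) *
            (M.submatrix (e ∘ u.succAbove) f).det * M (e u) p := by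
    rw [Matrix.det_succ_column _ (Fin.last j)]
    refine Finset.sum_congr rfl fun u _ => ?_
    have h : (M.submatrix e (Fin.snoc f p : Fin (j + 1) → Fin (n + 1))).submatrix
        u.succAbove (Fin.last j).succAbove = M.submatrix (e ∘ u.succAbove) f := by
      ext a b
      simp
    rw [h]
    simp only [Matrix.submatrix_apply, Fin.snoc_last, Fin.val_last]
    ring
  have cofactor (u : Fin (j + 1)) :
      ∑ p : Fin (n + 1), M (e u) p * ((-1 : R) ^ ((e (Fin.last j) : ℕ) + (p : ℕ)) *
          (M.submatrix (e (Fin.last j)).succAbove p.succAbove).det)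
        = if u = Fin.last j then M.det else 0 := by
    have h := congrFun (congrFun (Matrix.mul_adjugate M) (e u)) (e (Fin.last j))
    simp only [Matrix.mul_apply, Matrix.adjugate_fin_succ_eq_det_submatrix, Matrix.smul_apply,
      Matrix.one_apply, he.eq_iff, smul_eq_mul, mul_ite, mul_one, mul_zero] at h
    exact h
  symm
  calc
    _ = ∑ u : Fin (j + 1), (-1 : R) ^ ((u : ℕ) + j) * (M.submatrix (e ∘ u.succAbove) f).det *
          ∑ p : Fin (n + 1), M (e u) p * ((-1 : R) ^ ((e (Fin.last j) : ℕ) + (p : ℕ)) *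
            (M.submatrix (e (Fin.last j)).succAbove p.succAbove).det) := by
      simp only [expand, Finset.mul_sum, Finset.sum_mul]
      rw [Finset.sum_comm]
      refine Finset.sum_congr rfl fun u _ => Finset.sum_congr rfl fun p _ => ?_
      ring
    _ = _ := by
      simp only [cofactor, mul_ite, mul_zero, Finset.sum_ite_eq', Finset.mem_univ, if_true,
        Fin.val_last, Fin.succAbove_last]
      rw [Even.neg_one_pow ⟨j, rfl⟩, one_mul]

theorem rowsBig_castLE {j r : ℕ} (s u : Fin (j + 1)) :
    rowsBig j r s (Fin.castLE (by omega) u)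
      = (Fin.snoc (rowsOmit j r s) (Fin.castLE (by omega) s) :
          Fin (j + 1) → Fin (j + r + 1)) u := by
  induction u using Fin.lastCases with
  | last => simp [rowsBig, Fin.snoc]
  | cast u =>
    have := u.isLt
    simp [rowsBig, rowsOmit, Fin.snoc]

theorem rowsBig_succAbove {j r : ℕ} (s : Fin (j + 1)) (u : Fin (j + r)) :
    rowsBig j r s ((Fin.castLE (by omega : j + 1 ≤ j + r + 1) (Fin.last j)).succAbove u)
      = (Fin.castLE (by omega : j + 1 ≤ j + r + 1) s).succAbove u := by
  have := s.isLt
  ext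
  by_cases h : (u : ℕ) < j
  · have h1 : (Fin.castLE (by omega : j + 1 ≤ j + r + 1) (Fin.last j)).succAbove u
        = Fin.castLE (by omega) (Fin.castSucc (⟨u, h⟩ : Fin j)) := by
      ext
      simp [Fin.succAbove, Fin.lt_def, h]
    rw [h1, rowsBig_castLE, Fin.snoc_castSucc]
    simp only [rowsOmit, Fin.succAbove, Fin.lt_def, Fin.val_castLE, Fin.val_castSucc]
    split_ifs <;> simp
  · have h1 : ¬ (u : ℕ) < s := by omega
    have h2 : ¬ (u : ℕ) + 1 < j + 1 := by omega
    simp [rowsBig, Fin.succAbove, Fin.lt_def, h, h1]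

theorem colsBig_castAdd {j r : ℕ} (k : Fin j → Fin (j + r + 1))
    (l : Fin (r + 1) → Fin (j + r + 1)) (a : Fin j) :
    colsBig k l (Fin.castAdd (r + 1) a) = k a := by
  simp [colsBig]

theorem colsBig_natAdd {j r : ℕ} (k : Fin j → Fin (j + r + 1))
    (l : Fin (r + 1) → Fin (j + r + 1)) (b : Fin (r + 1)) :
    colsBig k l (Fin.natAdd j b) = l b := by
  simp [colsBig]

theorem colsBig_succAbove {j r : ℕ} (k : Fin j → Fin (j + r + 1))
    (l : Fin (r + 1) → Fin (j + r + 1)) (b : Fin (r + 1)) (v : Fin (j + r)) :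
    colsBig k l (Fin.succAbove (n := j + r) (Fin.natAdd j b) v) = colsOmit k l b v := by
  have hv := v.isLt
  by_cases h : (v : ℕ) < j
  · have h1 : (v : ℕ) < j + b := by omega
    simp [colsBig, colsOmit, Fin.succAbove, Fin.lt_def, h, h1]
  · by_cases h1 : (v : ℕ) < j + b
    · have h2 : (v : ℕ) - j < b := by omega
      simp [colsBig, colsOmit, Fin.succAbove, Fin.lt_def, h, h1, h2]
    · have h2 : ¬ (v : ℕ) - j < b := by omega
      have h3 : ¬ (v : ℕ) + 1 < j := by omega
      have h4 : (v : ℕ) + 1 - j = v - j + 1 := by omega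
      simp [colsBig, colsOmit, Fin.succAbove, Fin.lt_def, h, h1, h2, h3, h4]

/-- generalized Laplace-type identity, Muir's law of extensible minors.
Let `R` be a commutative ring, `m = j + r + 1` (so `0 ≤ j < m`), `C` an `m×m` matrix over
`R`, `k₁ < … < k_j` strictly increasing indices, `s` with `1 ≤ s ≤ j+1`, and let
`l₁ < … < l_{m−j}` enumerate the complement `{1,…,m} \ {k₁,…,k_j}` in increasing order.
Then
`C(1,…,ŝ,…,j+1 | k) · C(1,…,ŝ,…,j+1, s, j+2,…,m | k, l)
  = ∑_{b=1}^{m−j} (−1)^{b+1} · C(1,…,ŝ,…,j+1, s | k, l_b)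
      · C(1,…,ŝ,…,j+1, j+2,…,m | k, l₁,…,l̂_b,…,l_{m−j})`.
(The sign `(−1)^{b+1}` with 1-based `b` equals `(−1)^{b₀}` for the 0-based `b₀ = b − 1`.) -/
theorem stmt6 {R : Type*} [CommRing R] {j r : ℕ}
    (C : Matrix (Fin (j + r + 1)) (Fin (j + r + 1)) R)
    (k : Fin j → Fin (j + r + 1)) (hk : StrictMono k)
    (l : Fin (r + 1) → Fin (j + r + 1)) (hl : StrictMono l)
    (hkl : ∀ x, x ∈ Set.range l ↔ x ∉ Set.range k)
    (s : Fin (j + 1)) :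
    (Matrix.of fun u v : Fin j => C (rowsOmit j r s u) (k v)).det *
        (Matrix.of fun u v : Fin (j + r + 1) => C (rowsBig j r s u) (colsBig k l v)).det
      = ∑ b : Fin (r + 1),
          (-1 : R) ^ (b : ℕ) *
            (Matrix.of fun u v : Fin (j + 1) =>
              C ((Fin.snoc (rowsOmit j r s) (Fin.castLE (by omega) s) :
                    Fin (j + 1) → Fin (j + r + 1)) u)
                ((Fin.snoc k (l b) : Fin (j + 1) → Fin (j + r + 1)) v)).det *
            (Matrix.of fun u v : Fin (j + r) =>
              C ((Fin.castLE (by omega : j + 1 ≤ j + r + 1) s).succAbove u)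
                (colsOmit k l b v)).det := by
  have key := det_submatrix_mul_det (n := j + r)
    (Matrix.of fun u v : Fin (j + r + 1) => C (rowsBig j r s u) (colsBig k l v))
    (Fin.castLE (by omega)) (Fin.castLE_injective _) (Fin.castAdd (r + 1))
  have sum_split := Fin.sum_univ_add (a := j) (b := r + 1) fun p : Fin (j + r + 1) =>
    (-1 : R) ^ (((Fin.castLE (by omega : j + 1 ≤ j + r + 1) (Fin.last j) : Fin _) : ℕ) + (p : ℕ)) *
      ((Matrix.of fun u v : Fin (j + r + 1) => C (rowsBig j r s u) (colsBig k l v)).submatrix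
        (Fin.castLE (by omega : j + 1 ≤ j + r + 1))
        (Fin.snoc (Fin.castAdd (r + 1)) p : Fin (j + 1) → Fin (j + r + 1))).det *
      ((Matrix.of fun u v : Fin (j + r + 1) => C (rowsBig j r s u) (colsBig k l v)).submatrix
        (Fin.castLE (by omega : j + 1 ≤ j + r + 1) (Fin.last j)).succAbove p.succAbove).det
  have first_zero (a : Fin j) :
      ((Matrix.of fun u v : Fin (j + r + 1) => C (rowsBig j r s u) (colsBig k l v)).submatrix
        (Fin.castLE (by omega : j + 1 ≤ j + r + 1))
        (Fin.snoc (Fin.castAdd (r + 1)) (Fin.castAdd (r + 1) a) :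
          Fin (j + 1) → Fin (j + r + 1))).det = 0 := by
    refine Matrix.det_zero_of_column_eq (Fin.castSucc_lt_last a).ne fun u => ?_
    simp only [Matrix.submatrix_apply, Fin.snoc_castSucc, Fin.snoc_last]
  replace key := key.trans sum_split
  simp only [first_zero, mul_zero, zero_mul, Finset.sum_const_zero, zero_add] at key
  convert key using 2
  · congr 1
    ext u v
    have hu := rowsBig_castLE (r := r) s u.castSucc
    rw [Fin.snoc_castSucc] at hu
    simp only [Matrix.of_apply, Matrix.submatrix_apply, Function.comp_apply, colsBig_castAdd, hu]
  · rename_i b _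
    congr 1
    · congr 1
      · rw [Fin.val_castLE, Fin.val_last, Fin.val_natAdd, ← add_assoc, pow_add,
          Even.neg_one_pow ⟨j, rfl⟩, one_mul]
      · congr 1
        ext u v
        simp only [Matrix.of_apply, Matrix.submatrix_apply, rowsBig_castLE]
        induction v using Fin.lastCases with
        | last => simp only [Fin.snoc_last, colsBig_natAdd]
        | cast v => simp only [Fin.snoc_castSucc, colsBig_castAdd]
    · congr 1
      ext u v
      simp only [Matrix.of_apply, Matrix.submatrix_apply, rowsBig_succAbove, colsBig_succAbove]

end Stmt6
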